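/- The number of equivalence classes of combinators over {M} under the rewrite equivalence, whose members have height h, equals a(h), where a(0) = a(1) = 1 and a(h) = a(h-1)^2 - a(h-1) + 2 a(h-1) * (sum_{i=1}^{h-1} a(i-1)) for h >= 2. The first values are 1, 1, 2, 10, 170, 33490. -/

import Mathlib

inductive MTerm : Type
  | M : MTerm
  | var : ℕ → MTerm
  | app : MTerm → MTerm → MTerm

/-- One-step rewrite of the Mockingbird system: replace a subterm `M s` by `s s`. -/
inductive MStep : MTerm → MTerm → Prop
  | mock (s : MTerm) : MStep (.app .M s) (.app s s)
  | left {t t' : MTerm} (u : MTerm) : MStep t t' → MStep (.app t u) (.app t' u)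
  | right (u : MTerm) {t t' : MTerm} : MStep t t' → MStep (.app u t) (.app u t')

/-- Rewrite order: reflexive-transitive closure of `MStep`. -/
def MLe : MTerm → MTerm → Prop := Relation.ReflTransGen MStep

/-- A term is a combinator when it contains no variable. -/
def NoVar : MTerm → Prop
  | .M => True
  | .var _ => False
  | .app a b => NoVar a ∧ NoVar b

/-- Subterm (factor) relation. -/
inductive MSub : MTerm → MTerm → Prop
  | refl (t : MTerm) : MSub t t
  | left {s a : MTerm} (b : MTerm) : MSub s a → MSub s (.app a b)
  | right (a : MTerm) {s b : MTerm} : MSub s b → MSub s (.app a b)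

/-- Height: maximal number of internal nodes on a root-to-leaf path. -/
def ht : MTerm → ℕ
  | .M => 0
  | .var _ => 0
  | .app a b => max (ht a) (ht b) + 1

/-- Degree: number of application (internal) nodes. -/
def deg : MTerm → ℕ
  | .M => 0
  | .var _ => 0
  | .app a b => deg a + deg b + 1

/-- a(0) = a(1) = 1 and a(h) = a(h-1)² - a(h-1) + 2 a(h-1) ∑_{i=1}^{h-1} a(i-1). -/
def seqA : ℕ → ℕ
  | 0 => 1
  | 1 => 1
  | h + 2 =>
      seqA (h + 1) ^ 2 - seqA (h + 1)
        + 2 * seqA (h + 1) * ∑ i ∈ (Finset.range (h + 1)).attach, seqA i.1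
  decreasing_by
  all_goals first
    | omega
    | (have := Finset.mem_range.mp i.2; omega)

namespace MockAux
open Classical

/-- Canonical representative: `M s` is turned into `s s` everywhere. -/
noncomputable def nf : MTerm → MTerm
  | .M => .M
  | .var n => .var n
  | .app a b => if nf a = .M then .app (nf b) (nf b) else .app (nf a) (nf b)

/-- Variable-free canonical terms. -/
def Norm : MTerm → Prop
  | .M => True
  | .var _ => False
  | .app a b => Norm a ∧ Norm b ∧ (a = .M → b = .M)

theorem nf_step {t u : MTerm} (h : MStep t u) : nf t = nf u := by
  induction h with
  | mock s => simp only [nf]; split_ifs <;> simp_all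
  | left u _ ih => simp only [nf, ih]
  | right u _ ih => simp only [nf, ih]

theorem nf_eqv {t u : MTerm} (h : Relation.EqvGen MStep t u) : nf t = nf u := by
  induction h with
  | rel _ _ h => exact nf_step h
  | refl _ => rfl
  | symm _ _ _ ih => exact ih.symm
  | trans _ _ _ _ _ ih1 ih2 => exact ih1.trans ih2

theorem eqv_app {a a' b b' : MTerm} (h1 : Relation.EqvGen MStep a a')
    (h2 : Relation.EqvGen MStep b b') :
    Relation.EqvGen MStep (.app a b) (.app a' b') := by
  refine Relation.EqvGen.trans _ (.app a' b) _ ?_ ?_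
  · induction h1 with
    | rel _ _ h => exact .rel _ _ (.left _ h)
    | refl _ => exact .refl _
    | symm _ _ _ ih => exact .symm _ _ ih
    | trans _ _ _ _ _ ih1 ih2 => exact .trans _ _ _ ih1 ih2
  · induction h2 with
    | rel _ _ h => exact .rel _ _ (.right _ h)
    | refl _ => exact .refl _
    | symm _ _ _ ih => exact .symm _ _ ih
    | trans _ _ _ _ _ ih1 ih2 => exact .trans _ _ _ ih1 ih2

theorem eqv_nf (t : MTerm) : Relation.EqvGen MStep t (nf t) := by
  induction t with
  | M => exact .refl _
  | var n => exact .refl _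
  | app a b iha ihb =>
    simp only [nf]
    split_ifs with h
    · rw [h] at iha
      exact .trans _ _ _ (eqv_app iha ihb) (.rel _ _ (.mock _))
    · exact eqv_app iha ihb

theorem nf_eq_M {t : MTerm} (h : nf t = .M) : t = .M := by
  cases t with
  | M => rfl
  | var n => exact h
  | app a b => simp only [nf] at h; split_ifs at h

theorem ht_step {t u : MTerm} (h : MStep t u) : ht t = ht u := by
  induction h with
  | mock s => simp [ht]
  | left u _ ih => simp only [ht, ih]
  | right u _ ih => simp only [ht, ih]

theorem ht_eqv {t u : MTerm} (h : Relation.EqvGen MStep t u) : ht t = ht u := by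
  induction h with
  | rel _ _ h => exact ht_step h
  | refl _ => rfl
  | symm _ _ _ ih => exact ih.symm
  | trans _ _ _ _ _ ih1 ih2 => exact ih1.trans ih2

theorem norm_nf {t : MTerm} (h : NoVar t) : Norm (nf t) := by
  induction t with
  | M => trivial
  | var n => exact h
  | app a b iha ihb =>
    simp only [nf]
    split_ifs with h'
    · exact ⟨ihb h.2, ihb h.2, id⟩
    · exact ⟨iha h.1, ihb h.2, fun e => absurd e h'⟩

theorem nf_norm {t : MTerm} (h : Norm t) : nf t = t := by
  induction t with
  | M => rfl
  | var n => rfl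
  | app a b iha ihb =>
    obtain ⟨ha, hb, hab⟩ := h
    simp only [nf, iha ha, ihb hb]
    split_ifs with h'
    · rw [h', hab h']
    · rfl

theorem noVar_norm {t : MTerm} (h : Norm t) : NoVar t := by
  induction t with
  | M => trivial
  | var n => exact h
  | app a b iha ihb => exact ⟨iha h.1, ihb h.2.1⟩

theorem ht_zero {t : MTerm} (h : Norm t) (h0 : ht t = 0) : t = .M := by
  cases t with
  | M => rfl
  | var n => exact h.elim
  | app a b => simp [ht] at h0

theorem seqA_rec (h : ℕ) : seqA (h + 2) = seqA (h + 1) ^ 2 - seqA (h + 1)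
        + 2 * seqA (h + 1) * ∑ i ∈ Finset.range (h + 1), seqA i := by
  rw [seqA, Finset.sum_attach (Finset.range (h + 1)) seqA]

theorem count (h : ℕ) : ∃ F : Finset MTerm, (∀ t, t ∈ F ↔ Norm t ∧ ht t = h) ∧
    F.card = seqA h := by
  induction h using Nat.strong_induction_on with
  | _ n IH =>
  match n, IH with
  | 0, _ =>
    refine ⟨{.M}, fun t => ?_, by simp [seqA]⟩
    rw [Finset.mem_singleton]
    exact ⟨fun e => by subst e; exact ⟨trivial, rfl⟩, fun e => ht_zero e.1 e.2⟩
  | 1, _ =>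
    refine ⟨{.app .M .M}, fun t => ?_, by simp [seqA]⟩
    rw [Finset.mem_singleton]
    constructor
    · rintro rfl
      exact ⟨⟨trivial, trivial, fun _ => rfl⟩, rfl⟩
    · rintro ⟨h1, h2⟩
      cases t with
      | M => simp [ht] at h2
      | var n => exact h1.elim
      | app a b =>
        simp only [ht] at h2
        rw [ht_zero h1.1 (by omega), ht_zero h1.2.1 (by omega)]
  | h + 2, IH =>
    choose! F hF hc using IH
    obtain ⟨L, hL⟩ : ∃ L, L = (Finset.range (h + 1)).biUnion F := ⟨_, rfl⟩
    have memL : ∀ t, t ∈ L ↔ Norm t ∧ ht t ≤ h := by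
      intro t
      rw [hL, Finset.mem_biUnion]
      constructor
      · rintro ⟨i, hi, ht'⟩
        rw [Finset.mem_range] at hi
        have := (hF i (by omega) t).1 ht'
        exact ⟨this.1, by omega⟩
      · rintro ⟨h1, h2⟩
        exact ⟨ht t, Finset.mem_range.2 (by omega), (hF _ (by omega) t).2 ⟨h1, rfl⟩⟩
    have cardL : L.card = ∑ i ∈ Finset.range (h + 1), seqA i := by
      rw [hL, Finset.card_biUnion]
      · exact Finset.sum_congr rfl fun i hi => hc i (by rw [Finset.mem_range] at hi; omega)
      · intro i hi j hj hij
        simp only [Finset.coe_range, Set.mem_Iio, Finset.mem_range] at hi hj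
        rw [Function.onFun, Finset.disjoint_left]
        intro t h1 h2
        have h1 := (hF i (by omega) t).1 h1
        have h2 := (hF j (by omega) t).1 h2
        omega
    have memT := hF (h + 1) (by omega)
    have cardT := hc (h + 1) (by omega)
    generalize F (h + 1) = T at memT cardT
    have hM : MTerm.M ∈ L := (memL _).2 ⟨trivial, by simp [ht]⟩
    have disj : ∀ t, t ∈ T → t ∈ L → False := by
      intro t h1 h2
      have h1 := (memT t).1 h1
      have h2 := (memL t).1 h2
      omega
    refine ⟨((T ×ˢ T ∪ T ×ˢ L) ∪ (L.erase .M) ×ˢ T).image (fun p => MTerm.app p.1 p.2), ?_, ?_⟩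
    · intro t
      simp only [Finset.mem_image, Finset.mem_union, Finset.mem_product, Finset.mem_erase, memL,
        memT, Prod.exists]
      constructor
      · rintro ⟨a, b, hab, rfl⟩
        have hM0 : ht .M = 0 := rfl
        rcases hab with (⟨h1, h2⟩ | ⟨h1, h2⟩) | ⟨h1, h2⟩
        · exact ⟨⟨h1.1, h2.1, fun e => by subst e; omega⟩, by simp only [ht]; omega⟩
        · exact ⟨⟨h1.1, h2.1, fun e => by subst e; omega⟩, by simp only [ht]; omega⟩
        · exact ⟨⟨h1.2.1, h2.1, fun e => absurd e h1.1⟩, by simp only [ht]; omega⟩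
      · rintro ⟨h1, h2⟩
        cases t with
        | M => simp [ht] at h2
        | var n => exact h1.elim
        | app a b =>
          obtain ⟨ha, hb, hab⟩ := h1
          simp only [ht] at h2
          refine ⟨a, b, ?_, rfl⟩
          by_cases e : ht a = h + 1
          · by_cases e' : ht b = h + 1
            · exact .inl (.inl ⟨⟨ha, e⟩, hb, e'⟩)
            · exact .inl (.inr ⟨⟨ha, e⟩, hb, by omega⟩)
          · refine .inr ⟨⟨fun e2 => ?_, ha, by omega⟩, hb, by omega⟩
            rw [e2, hab e2] at h2
            simp [ht] at h2
    · rw [Finset.card_image_of_injective, Finset.card_union_of_disjoint,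
        Finset.card_union_of_disjoint, Finset.card_product, Finset.card_product,
        Finset.card_product, Finset.card_erase_of_mem hM, seqA_rec, ← cardL, ← cardT]
      · have hpos : 1 ≤ L.card := Finset.card_pos.2 ⟨_, hM⟩
        obtain ⟨k, hk⟩ := Nat.exists_eq_add_of_le hpos
        rw [hk]
        have : T.card ≤ T.card ^ 2 := Nat.le_self_pow (by norm_num) _
        zify [this]
        simp
        ring
      · rw [Finset.disjoint_left]
        rintro ⟨a, b⟩ h1 h2
        rw [Finset.mem_product] at h1 h2
        exact disj _ h1.2 h2.2
      · rw [Finset.disjoint_left]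
        rintro ⟨a, b⟩ h1 h2
        simp only [Finset.mem_union, Finset.mem_product, Finset.mem_erase] at h1 h2
        exact disj a (by tauto) h2.1.2
      · rintro ⟨a, b⟩ ⟨c, d⟩ e
        simpa using e

theorem card_classes (h : ℕ) :
    Nat.card {s : Set MTerm //
        ∃ t : MTerm, NoVar t ∧ ht t = h ∧ s = {u | Relation.EqvGen MStep t u}} = seqA h := by
  obtain ⟨F, hF, hc⟩ := count h
  rw [← hc, ← Nat.card_eq_finsetCard F]
  symm
  refine Nat.card_eq_of_bijective
    (fun t : F => ⟨{u | Relation.EqvGen MStep t.1 u}, t.1, noVar_norm ((hF _).1 t.2).1,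
      ((hF _).1 t.2).2, rfl⟩) ⟨?_, ?_⟩
  · rintro ⟨t, ht1⟩ ⟨u, hu⟩ e
    have e := congrArg Subtype.val e
    have hmem : u ∈ {v | Relation.EqvGen MStep t v} := by
      rw [show {v | Relation.EqvGen MStep t v} = {v | Relation.EqvGen MStep u v} from e]
      exact .refl _
    have := nf_eqv hmem
    rw [nf_norm ((hF _).1 ht1).1, nf_norm ((hF _).1 hu).1] at this
    exact Subtype.ext this
  · rintro ⟨s, t, h1, h2, rfl⟩
    refine ⟨⟨nf t, (hF _).2 ⟨norm_nf h1, by rw [← ht_eqv (eqv_nf t), h2]⟩⟩, Subtype.ext ?_⟩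
    ext u
    exact ⟨fun e => .trans _ _ _ (eqv_nf t) e, fun e => .trans _ _ _ (.symm _ _ (eqv_nf t)) e⟩

end MockAux

/-- The number of equivalence classes (under the rewrite equivalence) of combinators
over {M} of height h equals a(h); the first values are 1, 1, 2, 10, 170, 33490. -/
theorem classes_by_height :
    (∀ h : ℕ,
      Nat.card {s : Set MTerm //
        ∃ t : MTerm, NoVar t ∧ ht t = h ∧ s = {u | Relation.EqvGen MStep t u}} = seqA h) ∧
    seqA 0 = 1 ∧ seqA 1 = 1 ∧ seqA 2 = 2 ∧ seqA 3 = 10 ∧ seqA 4 = 170 ∧ seqA 5 = 33490 := by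
  have h2 : seqA 2 = 2 := by
    rw [MockAux.seqA_rec]; simp [seqA, Finset.sum_range_succ]
  have h3 : seqA 3 = 10 := by
    rw [MockAux.seqA_rec]; simp [h2, seqA, Finset.sum_range_succ]
  have h4 : seqA 4 = 170 := by
    rw [MockAux.seqA_rec]; simp [h2, h3, seqA, Finset.sum_range_succ]
  have h5 : seqA 5 = 33490 := by
    rw [MockAux.seqA_rec]; simp [h2, h3, h4, seqA, Finset.sum_range_succ]
  exact ⟨MockAux.card_classes, by simp [seqA], by simp [seqA], h2, h3, h4, h5⟩
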